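/- arXiv:1004.4883 — 4 statements merged into one kernel-verified Lean document; each statement's English description precedes it below -/
import Mathlib

section
/- Let z₁, …, zₙ ∈ ℝ^m and let kₙ = max over nonzero θ ∈ ℝ^m of #{i : θ′z_i = 0}. Then for every δ with 0.5 < δ < 1 − kₙ/n there exists ε > 0 such that for every θ ∈ ℝ^m with ‖θ‖ = 1, #{i : |θ′z_i| > ε} ≥ δ·n. -/
open MeasureTheory Matrix Filter ProbabilityTheory

noncomputable section

/-- Euclidean norm of a vector in `Fin q → ℝ`. -/
def euclNorm {q : ℕ} (v : Fin q → ℝ) : ℝ := Real.sqrt (∑ i, v i ^ 2)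

/-- Frobenius (2-)norm of a matrix. -/
def frobNorm {p q : ℕ} (A : Matrix (Fin p) (Fin q) ℝ) : ℝ :=
  Real.sqrt (∑ i, ∑ j, A i j ^ 2)

/-- Spectral (operator) norm of a matrix. -/
def specNorm {p q : ℕ} (A : Matrix (Fin p) (Fin q) ℝ) : ℝ :=
  sSup ((fun v => euclNorm (A *ᵥ v)) '' {v | euclNorm v = 1})

/-- Squared Mahalanobis norm `u′ Σ⁻¹ u`. -/
def mahSq {q : ℕ} (Sig : Matrix (Fin q) (Fin q) ℝ) (u : Fin q → ℝ) : ℝ :=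
  u ⬝ᵥ (Sig⁻¹ *ᵥ u)

/-- Mahalanobis norm `(u′ Σ⁻¹ u)^{1/2}`. -/
def mah {q : ℕ} (Sig : Matrix (Fin q) (Fin q) ℝ) (u : Fin q → ℝ) : ℝ :=
  Real.sqrt (mahSq Sig u)

/-- Residual `y − B′x` of the observation `z = (y, x)`. -/
def resid {p q : ℕ} (B : Matrix (Fin p) (Fin q) ℝ) (z : (Fin q → ℝ) × (Fin p → ℝ)) :
    Fin q → ℝ :=
  z.1 - Bᵀ *ᵥ z.2

/-- Mahalanobis norm of the residual of the observation `z` w.r.t. `(B, Σ)`. -/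
def dMah {p q : ℕ} (B : Matrix (Fin p) (Fin q) ℝ) (Sig : Matrix (Fin q) (Fin q) ℝ)
    (z : (Fin q → ℝ) × (Fin p → ℝ)) : ℝ :=
  mah Sig (resid B z)

/-- A ρ-function: continuous, with values in `[0,1]`, `ρ(0)=0`, nondecreasing in `|u|`,
`sup ρ = 1`, and strictly increasing on `{u ≥ 0 : ρ u < 1}`. -/
structure IsRhoFunction (ρ : ℝ → ℝ) : Prop where
  continuous : Continuous ρ
  map_zero : ρ 0 = 0
  nonneg : ∀ u, 0 ≤ ρ u
  le_one : ∀ u, ρ u ≤ 1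
  mono_abs : ∀ u v : ℝ, |u| ≤ |v| → ρ u ≤ ρ v
  sup_eq_one : (⨆ u : ℝ, ρ u) = 1
  strict : ∀ u v : ℝ, 0 ≤ u → u < v → ρ u < 1 → ρ u < ρ v

/-- `s` is an M-estimate of scale of `v₁, …, vₙ` with ρ-function `ρ₀` and constant `b`. -/
def IsMScale {n : ℕ} (ρ₀ : ℝ → ℝ) (b : ℝ) (v : Fin n → ℝ) (s : ℝ) : Prop :=
  (0 < s ∧ ∑ i, ρ₀ (v i / s) = b * n) ∨
    (s = 0 ∧ (n : ℝ) * (1 - b) ≤ (Finset.univ.filter (fun i => v i = 0)).card)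

/-- If at every point of a compact set at least `N` of finitely many continuous functions are
nonzero, then at every point at least `N` of them exceed a common `ε > 0` in absolute value. -/
theorem IsCompact.exists_pos_le_card_filter_lt_abs {X ι : Type*} [TopologicalSpace X] [Fintype ι]
    {K : Set X} (hK : IsCompact K) {f : ι → X → ℝ} (hf : ∀ i, Continuous (f i)) {N : ℕ}
    (h : ∀ x ∈ K, N ≤ (Finset.univ.filter (fun i => f i x ≠ 0)).card) :
    ∃ ε > (0 : ℝ), ∀ x ∈ K, N ≤ (Finset.univ.filter (fun i => ε < |f i x|)).card := by
  refine hK.induction_on (p := fun s => ∃ ε > (0 : ℝ), ∀ x ∈ s,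
    N ≤ (Finset.univ.filter (fun i => ε < |f i x|)).card) ⟨1, one_pos, by simp⟩ ?_ ?_ ?_
  · rintro s t hst ⟨ε, hε, ht⟩
    exact ⟨ε, hε, fun x hx => ht x (hst hx)⟩
  · rintro s t ⟨ε₁, hε₁, hs⟩ ⟨ε₂, hε₂, ht⟩
    refine ⟨min ε₁ ε₂, lt_min hε₁ hε₂, ?_⟩
    rintro x (hx | hx)
    · refine (hs x hx).trans (Finset.card_le_card ?_)
      exact Finset.monotone_filter_right _ fun i _ hi => (min_le_left _ _).trans_lt hi
    · refine (ht x hx).trans (Finset.card_le_card ?_)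
      exact Finset.monotone_filter_right _ fun i _ hi => (min_le_right _ _).trans_lt hi
  · intro x hx
    have hsmall : ∀ᶠ ε in nhdsWithin (0 : ℝ) (Set.Ioi 0), ∀ i, f i x ≠ 0 → ε < |f i x| := by
      refine eventually_all.2 fun i => ?_
      by_cases hi : f i x = 0
      · simp [hi]
      · filter_upwards [nhdsWithin_le_nhds (Iio_mem_nhds (abs_pos.2 hi))] with ε hε _
        exact hε
    obtain ⟨ε, hε, hpos⟩ := (hsmall.and self_mem_nhdsWithin).exists
    have hnear : ∀ᶠ y in nhds x, ∀ i, f i x ≠ 0 → ε < |f i y| := by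
      refine eventually_all.2 fun i => ?_
      by_cases hi : f i x = 0
      · simp [hi]
      · filter_upwards [(hf i).abs.continuousAt.eventually (lt_mem_nhds (hε i hi))] with y hy _
        exact hy
    refine ⟨_, nhdsWithin_le_nhds hnear, ε, hpos, fun y hy => (h x hx).trans ?_⟩
    exact Finset.card_le_card (Finset.monotone_filter_right _ fun i _ hi => hy i hi)

theorem isCompact_setOf_euclNorm_eq_one (m : ℕ) :
    IsCompact {θ : Fin m → ℝ | euclNorm θ = 1} := by
  refine (isCompact_univ_pi fun _ => isCompact_Icc (a := (-1 : ℝ)) (b := 1)).of_isClosed_subset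
    (isClosed_eq (by unfold euclNorm; fun_prop) continuous_const) fun θ hθ i _ => ?_
  have hsum : ∑ j, θ j ^ 2 = 1 := Real.sqrt_eq_one.1 hθ
  have hi : θ i ^ 2 ≤ 1 :=
    hsum ▸ Finset.single_le_sum (fun j _ => sq_nonneg (θ j)) (Finset.mem_univ i)
  exact abs_le.1 ((sq_le_one_iff_abs_le_one _).1 hi)

/-- If `kₙ` is the maximal number of the points `z₁,…,zₙ ∈ ℝ^m` lying on a
hyperplane through the origin, then for every `δ` with `1/2 < δ < 1 − kₙ/n` there is an
`ε > 0` such that every unit vector `θ` satisfies `#{i : |θ′zᵢ| > ε} ≥ δ·n`. -/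
theorem exists_eps_card_dotProduct_gt {m n : ℕ} (z : Fin n → (Fin m → ℝ)) (kn : ℕ)
    (hkn : IsGreatest
      {k : ℕ | ∃ θ : Fin m → ℝ, θ ≠ 0 ∧
        k = (Finset.univ.filter (fun i => θ ⬝ᵥ z i = 0)).card} kn)
    (δ : ℝ) (hδ₁ : 1 / 2 < δ) (hδ₂ : δ < 1 - (kn : ℝ) / n) :
    ∃ ε > (0 : ℝ), ∀ θ : Fin m → ℝ, euclNorm θ = 1 →
      δ * n ≤ ((Finset.univ.filter (fun i => ε < |θ ⬝ᵥ z i|)).card : ℝ) := by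
  have hcard : ∀ θ ∈ {θ : Fin m → ℝ | euclNorm θ = 1},
      n - kn ≤ (Finset.univ.filter (fun i => θ ⬝ᵥ z i ≠ 0)).card := by
    intro θ hθ
    have hθ₀ : θ ≠ 0 := by
      rintro rfl
      simp [euclNorm] at hθ
    have hle := hkn.2 ⟨θ, hθ₀, rfl⟩
    have hadd := Finset.card_filter_add_card_filter_not
      (s := (Finset.univ : Finset (Fin n))) (fun i => θ ⬝ᵥ z i = 0)
    rw [Finset.card_univ, Fintype.card_fin] at hadd
    simp only [ne_eq]
    omega
  obtain ⟨ε, hε, h⟩ := (isCompact_setOf_euclNorm_eq_one m).exists_pos_le_card_filter_lt_abs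
    (f := fun i θ => θ ⬝ᵥ z i) (fun i => by fun_prop) hcard
  refine ⟨ε, hε, fun θ hθ => ?_⟩
  rcases n.eq_zero_or_pos with rfl | hn
  · simp
  have hn' : (0 : ℝ) < n := Nat.cast_pos.2 hn
  calc δ * n ≤ (1 - (kn : ℝ) / n) * n := by gcongr
    _ = (n : ℝ) - kn := by field_simp
    _ ≤ ((n - kn : ℕ) : ℝ) := by
      rw [sub_le_iff_le_add]
      exact_mod_cast le_tsub_add
    _ ≤ _ := Nat.cast_le.2 (h θ hθ)
end
end

section
/- Let z_i = (y_i′, x_i′), i = 1, …, n, with y_i ∈ ℝ^q and x_i ∈ ℝ^p, let kₙ = max over (v,w) ∈ ℝ^p × ℝ^q with ‖v‖+‖w‖ > 0 of #{i : v′x_i + w′y_i = 0}, and assume kₙ/n < 0.5. Let ρ₁ be a ρ-function and σ̂ > 0. Then there exist t₁ > 0 and t₂ > 0 such that for every (B, Γ) ∈ ℝ^{p×q} × S_q with det Γ = 1 satisfying λ_q(Γ) ≤ t₁ or ‖B‖₂ ≥ t₂ (where λ_q(Γ) is the smallest eigenvalue of Γ and ‖·‖₂ the Frobenius norm), one has ∑_{i=1}^n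 ρ₁(d_i(B, Γ)/σ̂) ≥ n/2. -/
open MeasureTheory Matrix Filter ProbabilityTheory

noncomputable section

/-- Cauchy–Schwarz for the Mahalanobis norm: `(w′u)² ≤ (w′Γw)(u′Γ⁻¹u)`. -/
lemma sq_dotProduct_le_mul_mahSq {q : ℕ} {Γ : Matrix (Fin q) (Fin q) ℝ} (hΓ : Γ.PosDef)
    (w u : Fin q → ℝ) : (w ⬝ᵥ u) ^ 2 ≤ (w ⬝ᵥ (Γ *ᵥ w)) * mahSq Γ u := by
  have hu : Γ *ᵥ (Γ⁻¹ *ᵥ u) = u := by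
    rw [mulVec_mulVec, mul_nonsing_inv _ ((isUnit_iff_isUnit_det _).1 hΓ.isUnit), one_mulVec]
  have hsymm : LinearMap.IsSymm (Matrix.toBilin' Γ) := ⟨fun x y => by
    have hT : Γᵀ = Γ := by simpa using hΓ.1.eq
    rw [RingHom.id_apply, Matrix.toBilin'_apply', Matrix.toBilin'_apply', dotProduct_mulVec,
      dotProduct_comm, ← mulVec_transpose, hT]⟩
  have hnonneg : ∀ x, 0 ≤ Matrix.toBilin' Γ x x := fun x => by
    simpa [Matrix.toBilin'_apply'] using hΓ.posSemidef.dotProduct_mulVec_nonneg x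
  have h := LinearMap.BilinForm.apply_sq_le_of_symm _ hnonneg hsymm w (Γ⁻¹ *ᵥ u)
  simp only [Matrix.toBilin'_apply', hu] at h
  rwa [mahSq, dotProduct_comm u]

lemma dotProduct_resid {p q : ℕ} (B : Matrix (Fin p) (Fin q) ℝ)
    (z : (Fin q → ℝ) × (Fin p → ℝ)) (w : Fin q → ℝ) :
    w ⬝ᵥ resid B z = (-(B *ᵥ w)) ⬝ᵥ z.2 + w ⬝ᵥ z.1 := by
  rw [resid, dotProduct_sub, dotProduct_mulVec, vecMul_transpose, neg_dotProduct]
  ring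

/-- If no nonzero `(v, w)` is orthogonal to all the observations indexed by `S`, then some such
observation has a product with `(v, w)` bounded below by a multiple of `‖(v, w)‖`. -/
lemma exists_pos_mul_norm_le_of_injective {p q n : ℕ}
    (z : Fin n → (Fin q → ℝ) × (Fin p → ℝ)) (S : Finset (Fin n))
    (hS : ∀ (v : Fin p → ℝ) (w : Fin q → ℝ),
      (∀ i ∈ S, v ⬝ᵥ (z i).2 + w ⬝ᵥ (z i).1 = 0) → v = 0 ∧ w = 0) :
    ∃ c > (0 : ℝ), ∀ (v : Fin p → ℝ) (w : Fin q → ℝ), ¬(v = 0 ∧ w = 0) →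
      ∃ i ∈ S, c * ‖(v, w)‖ ≤ |v ⬝ᵥ (z i).2 + w ⬝ᵥ (z i).1| := by
  let T : (Fin p → ℝ) × (Fin q → ℝ) →ₗ[ℝ] (S → ℝ) :=
    { toFun := fun a i => a.1 ⬝ᵥ (z i).2 + a.2 ⬝ᵥ (z i).1
      map_add' := fun a b => by
        ext i
        simp only [Prod.fst_add, Prod.snd_add, add_dotProduct, Pi.add_apply]
        ring
      map_smul' := fun r a => by
        ext i
        simp [smul_dotProduct, mul_add] }
  have hker : LinearMap.ker T = ⊥ := by
    refine LinearMap.ker_eq_bot'.2 fun a ha => ?_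
    have := hS a.1 a.2 fun i hi => congrFun ha ⟨i, hi⟩
    exact Prod.ext this.1 this.2
  obtain ⟨K, hK, hT⟩ := T.exists_antilipschitzWith hker
  have hK' : (0 : ℝ) < K := hK
  refine ⟨(K : ℝ)⁻¹ / 2, by positivity, fun v w hvw => ?_⟩
  have hpos : 0 < ‖(v, w)‖ := norm_pos_iff.2 fun h => hvw (Prod.mk_eq_zero.1 h)
  by_contra! hlt
  have hle : ‖T (v, w)‖ ≤ (K : ℝ)⁻¹ / 2 * ‖(v, w)‖ :=
    (pi_norm_le_iff_of_nonneg (by positivity)).2 fun i => (hlt i i.2).le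
  have hanti : ‖(v, w)‖ ≤ K * ‖T (v, w)‖ := hT.le_mul_norm (map_zero T) _
  have : (K : ℝ) * ‖T (v, w)‖ ≤ ‖(v, w)‖ / 2 := by
    calc (K : ℝ) * ‖T (v, w)‖ ≤ K * ((K : ℝ)⁻¹ / 2 * ‖(v, w)‖) := by gcongr
      _ = ‖(v, w)‖ / 2 := by field_simp
  linarith

/-- If at most `k` observations lie on a common hyperplane through the origin, then at most `k`
observations lie in a common slab of some uniform relative width `δ`. -/
lemma exists_pos_card_filter_lt_le {p q n : ℕ}
    (z : Fin n → (Fin q → ℝ) × (Fin p → ℝ)) (k : ℕ)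
    (hk : ∀ (v : Fin p → ℝ) (w : Fin q → ℝ), ¬(v = 0 ∧ w = 0) →
      (Finset.univ.filter (fun i => v ⬝ᵥ (z i).2 + w ⬝ᵥ (z i).1 = 0)).card ≤ k) :
    ∃ δ > (0 : ℝ), ∀ (v : Fin p → ℝ) (w : Fin q → ℝ), ¬(v = 0 ∧ w = 0) →
      (Finset.univ.filter
        (fun i => |v ⬝ᵥ (z i).2 + w ⬝ᵥ (z i).1| < δ * ‖(v, w)‖)).card ≤ k := by
  have hex : ∀ S : Finset (Fin n), ∃ c > (0 : ℝ), k < S.card →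
      ∀ (v : Fin p → ℝ) (w : Fin q → ℝ), ¬(v = 0 ∧ w = 0) →
        ∃ i ∈ S, c * ‖(v, w)‖ ≤ |v ⬝ᵥ (z i).2 + w ⬝ᵥ (z i).1| := by
    intro S
    by_cases hS : k < S.card
    · obtain ⟨c, hc, h⟩ := exists_pos_mul_norm_le_of_injective z S fun v w h => by
        by_contra hvw
        refine absurd (hk v w hvw) (not_le.2 (hS.trans_le (Finset.card_le_card fun i hi => ?_)))
        simpa using h i hi
      exact ⟨c, hc, fun _ => h⟩
    · exact ⟨1, one_pos, fun h => absurd h hS⟩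
  choose c hc h using hex
  refine ⟨Finset.univ.inf' Finset.univ_nonempty c,
    (Finset.lt_inf'_iff _).2 fun S _ => hc S, fun v w hvw => ?_⟩
  by_contra! hcard
  obtain ⟨i, hi, hle⟩ := h _ hcard v w hvw
  refine absurd (Finset.mem_filter.1 hi).2 (not_lt.2 (le_trans ?_ hle))
  gcongr
  exact Finset.inf'_le _ (Finset.mem_univ _)

lemma IsRhoFunction.exists_lt {ρ : ℝ → ℝ} (hρ : IsRhoFunction ρ) {c : ℝ} (hc : c < 1) :
    ∃ u, c < ρ u :=
  exists_lt_of_lt_ciSup (hρ.sup_eq_one.symm ▸ hc)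

/-- If a direction `w` has small variance `w′Γw` relative to `‖(-Bw, w)‖`, then all but `k` of the
residuals have large Mahalanobis norm. -/
lemma card_filter_dMah_lt_le {p q n : ℕ} {z : Fin n → (Fin q → ℝ) × (Fin p → ℝ)} {k : ℕ} {δ : ℝ}
    (hδ : 0 < δ)
    (hcard : ∀ (v : Fin p → ℝ) (w : Fin q → ℝ), ¬(v = 0 ∧ w = 0) →
      (Finset.univ.filter
        (fun i => |v ⬝ᵥ (z i).2 + w ⬝ᵥ (z i).1| < δ * ‖(v, w)‖)).card ≤ k)
    {B : Matrix (Fin p) (Fin q) ℝ} {Γ : Matrix (Fin q) (Fin q) ℝ} (hΓ : Γ.PosDef) {R : ℝ}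
    {w : Fin q → ℝ} (hw : w ≠ 0)
    (hR : R ^ 2 * (w ⬝ᵥ (Γ *ᵥ w)) ≤ δ ^ 2 * ‖(-(B *ᵥ w), w)‖ ^ 2) :
    (Finset.univ.filter (fun i => dMah B Γ (z i) < R)).card ≤ k := by
  refine le_trans (Finset.card_le_card fun i => ?_) (hcard (-(B *ᵥ w)) w fun h => hw h.2)
  simp only [Finset.mem_filter, Finset.mem_univ, true_and]
  contrapose!
  intro hle
  rw [← dotProduct_resid] at hle
  have hpos : 0 < w ⬝ᵥ (Γ *ᵥ w) := by simpa using hΓ.dotProduct_mulVec_pos hw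
  have hsq : (δ * ‖(-(B *ᵥ w), w)‖) ^ 2 ≤ (w ⬝ᵥ resid B (z i)) ^ 2 := by
    rw [← sq_abs (w ⬝ᵥ _)]
    gcongr
  have hCS := sq_dotProduct_le_mul_mahSq hΓ w (resid B (z i))
  refine Real.le_sqrt_of_sq_le (le_of_mul_le_mul_left ?_ hpos)
  rw [mul_pow] at hsq
  linarith

lemma IsRhoFunction.half_le_sum {n k : ℕ} {ρ : ℝ → ℝ} (hρ : IsRhoFunction ρ) {u σ : ℝ}
    (hσ : 0 < σ) (hu : (n : ℝ) / 2 ≤ (n - k) * ρ u) (d : Fin n → ℝ)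
    (hd : (Finset.univ.filter (fun i => d i < |u| * σ)).card ≤ k) :
    (n : ℝ) / 2 ≤ ∑ i, ρ (d i / σ) := by
  have hsplit := Finset.card_filter_add_card_filter_not (s := (Finset.univ : Finset (Fin n)))
    (fun i => d i < |u| * σ)
  rw [Finset.card_univ, Fintype.card_fin] at hsplit
  have hn : (n : ℝ) - k ≤ (Finset.univ.filter (fun i => ¬ d i < |u| * σ)).card := by
    have : n ≤ k + (Finset.univ.filter (fun i => ¬ d i < |u| * σ)).card := by omega
    have : (n : ℝ) ≤ k + (Finset.univ.filter (fun i => ¬ d i < |u| * σ)).card := by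
      exact_mod_cast this
    linarith
  calc (n : ℝ) / 2 ≤ (n - k) * ρ u := hu
    _ ≤ (Finset.univ.filter (fun i => ¬ d i < |u| * σ)).card * ρ u := by
      gcongr
      exact hρ.nonneg u
    _ = ∑ i ∈ Finset.univ.filter (fun i => ¬ d i < |u| * σ), ρ u := by simp
    _ ≤ ∑ i ∈ Finset.univ.filter (fun i => ¬ d i < |u| * σ), ρ (d i / σ) := by
      refine Finset.sum_le_sum fun i hi => hρ.mono_abs _ _ ?_
      have hi' : |u| * σ ≤ d i := not_lt.1 (Finset.mem_filter.1 hi).2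
      exact ((le_div_iff₀ hσ).2 hi').trans (le_abs_self _)
    _ ≤ ∑ i, ρ (d i / σ) :=
      Finset.sum_le_sum_of_subset_of_nonneg (Finset.filter_subset _ _) fun i _ _ => hρ.nonneg _

/-- A positive definite matrix of determinant one with eigenvalues at least `t` has diagonal
entries at most `q / t ^ (q - 1)`. -/
lemma diag_le_of_det_eq_one {q : ℕ} {Γ : Matrix (Fin q) (Fin q) ℝ} (hΓ : Γ.PosDef)
    (hdet : Γ.det = 1) {t : ℝ} (ht : 0 < t) (hev : ∀ i, t ≤ hΓ.1.eigenvalues i) (j : Fin q) :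
    Γ j j ≤ q / t ^ (q - 1) := by
  have hle : ∀ i, hΓ.1.eigenvalues i ≤ 1 / t ^ (q - 1) := fun i => by
    rw [le_div_iff₀ (by positivity)]
    have hprod : ∏ i, hΓ.1.eigenvalues i = 1 := by
      simpa [hdet] using hΓ.1.det_eq_prod_eigenvalues.symm
    rw [← Finset.mul_prod_erase _ _ (Finset.mem_univ i)] at hprod
    rw [← hprod]
    gcongr
    · exact (hΓ.eigenvalues_pos i).le
    · have := Finset.prod_le_prod (s := Finset.univ.erase i) (f := fun _ => t)
        (g := hΓ.1.eigenvalues) (fun _ _ => ht.le) fun i _ => hev i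
      simpa [Finset.card_erase_of_mem] using this
  calc Γ j j ≤ ∑ i, Γ i i :=
        Finset.single_le_sum (f := fun i => Γ i i) (fun i _ => hΓ.diag_pos.le) (Finset.mem_univ j)
    _ = ∑ i, hΓ.1.eigenvalues i := by simpa [Matrix.trace] using hΓ.1.trace_eq_sum_eigenvalues
    _ ≤ ∑ _i : Fin q, 1 / t ^ (q - 1) := Finset.sum_le_sum fun i _ => hle i
    _ = q / t ^ (q - 1) := by simp [div_eq_mul_inv]

/-- A matrix of large Frobenius norm has a large entry. -/
lemma exists_le_sq_of_lt_frobNorm {p q : ℕ} {B : Matrix (Fin p) (Fin q) ℝ} {M : ℝ}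
    (hB : √(p * q * M) < frobNorm B) : ∃ i j, M ≤ B i j ^ 2 := by
  by_contra! hlt
  refine absurd hB (not_lt.2 (Real.sqrt_le_sqrt ?_))
  calc ∑ i, ∑ j, B i j ^ 2 ≤ ∑ _i : Fin p, ∑ _j : Fin q, M :=
        Finset.sum_le_sum fun i _ => Finset.sum_le_sum fun j _ => (hlt i j).le
    _ = p * q * M := by simp [mul_assoc]

lemma dotProduct_self_le_card_mul_norm_sq {q : ℕ} (w : Fin q → ℝ) :
    w ⬝ᵥ w ≤ q * ‖w‖ ^ 2 := by
  calc w ⬝ᵥ w = ∑ i, ‖w i‖ ^ 2 := by simp [dotProduct, sq]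
    _ ≤ ∑ _i : Fin q, ‖w‖ ^ 2 := by
      gcongr with i
      exact norm_le_pi_norm w i
    _ = q * ‖w‖ ^ 2 := by simp

/-- if `kₙ/n < 1/2`, there exist `t₁ > 0`, `t₂ > 0` such that every `(B, Γ)`
with `Γ` symmetric positive definite, `det Γ = 1`, and either the smallest eigenvalue
`λ_q(Γ) ≤ t₁` or `‖B‖₂ ≥ t₂`, satisfies `∑ᵢ ρ₁(dᵢ(B,Γ)/σ̂) ≥ n/2`. -/
theorem exists_bounds_sum_rho_ge_half {p q n : ℕ}
    (z : Fin n → (Fin q → ℝ) × (Fin p → ℝ)) (kn : ℕ)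
    (hkn : IsGreatest
      {k : ℕ | ∃ v : Fin p → ℝ, ∃ w : Fin q → ℝ, ¬(v = 0 ∧ w = 0) ∧
        k = (Finset.univ.filter (fun i => v ⬝ᵥ (z i).2 + w ⬝ᵥ (z i).1 = 0)).card} kn)
    (hhalf : (kn : ℝ) / n < 1 / 2)
    (ρ₁ : ℝ → ℝ) (hρ₁ : IsRhoFunction ρ₁) (σhat : ℝ) (hσ : 0 < σhat) :
    ∃ t₁ > (0 : ℝ), ∃ t₂ > (0 : ℝ),
      ∀ (B : Matrix (Fin p) (Fin q) ℝ) (Γ : Matrix (Fin q) (Fin q) ℝ) (hΓ : Γ.PosDef),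
        Γ.det = 1 →
        ((∃ i, hΓ.1.eigenvalues i ≤ t₁) ∨ t₂ ≤ frobNorm B) →
        (n : ℝ) / 2 ≤ ∑ i, ρ₁ (dMah B Γ (z i) / σhat) := by
  obtain ⟨δ, hδ, hcard⟩ := exists_pos_card_filter_lt_le z kn
    fun v w hvw => hkn.2 ⟨v, w, hvw, rfl⟩
  obtain ⟨u, hu⟩ : ∃ u, (n : ℝ) / 2 ≤ (n - kn) * ρ₁ u := by
    rcases Nat.eq_zero_or_pos n with rfl | hn
    · exact ⟨0, by simp [hρ₁.map_zero]⟩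
    · have hn' : (0 : ℝ) < n := by exact_mod_cast hn
      rw [div_lt_iff₀ hn'] at hhalf
      have hpos : (0 : ℝ) < n - kn := by linarith
      obtain ⟨u, hu⟩ := hρ₁.exists_lt (c := n / 2 / (n - kn)) (by
        rw [div_lt_one hpos]
        linarith)
      exact ⟨u, ((div_lt_iff₀' hpos).1 hu).le⟩
  set R := |u| * σhat
  set t₁ : ℝ := δ ^ 2 / ((R ^ 2 + 1) * (q + 1)) with ht₁
  have ht₁pos : 0 < t₁ := by positivity
  set M : ℝ := R ^ 2 * (q / t₁ ^ (q - 1)) / δ ^ 2 with hM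
  refine ⟨t₁, ht₁pos, √(p * q * M) + 1, by positivity, fun B Γ hΓ hdet h => ?_⟩
  refine hρ₁.half_le_sum hσ hu _ ?_
  by_cases hsmall : ∃ i, hΓ.1.eigenvalues i ≤ t₁
  · obtain ⟨i, hi⟩ := hsmall
    set w : Fin q → ℝ := (hΓ.1.eigenvectorBasis i).ofLp with hw
    have hw0 : w ≠ 0 := fun h0 => hΓ.1.eigenvectorBasis.orthonormal.ne_zero i
      ((WithLp.ofLp_eq_zero 2).1 h0)
    refine card_filter_dMah_lt_le hδ hcard hΓ hw0 ?_
    have hww : 0 ≤ w ⬝ᵥ w := by simpa using dotProduct_star_self_nonneg w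
    have hnorm : ‖w‖ ≤ ‖(-(B *ᵥ w), w)‖ := norm_snd_le (-(B *ᵥ w), w)
    calc R ^ 2 * (w ⬝ᵥ (Γ *ᵥ w)) = R ^ 2 * (hΓ.1.eigenvalues i * (w ⬝ᵥ w)) := by
          rw [hw, hΓ.1.mulVec_eigenvectorBasis, dotProduct_smul, smul_eq_mul]
      _ ≤ (R ^ 2 + 1) * (t₁ * ((q + 1) * ‖w‖ ^ 2)) := by
          have := dotProduct_self_le_card_mul_norm_sq w
          gcongr
          · exact mul_nonneg (hΓ.eigenvalues_pos i).le hww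
          · linarith
          · nlinarith [sq_nonneg ‖w‖]
      _ = δ ^ 2 * ‖w‖ ^ 2 := by
          rw [ht₁]
          field_simp
      _ ≤ δ ^ 2 * ‖(-(B *ᵥ w), w)‖ ^ 2 := by gcongr
  · have hB : √(p * q * M) < frobNorm B := by
      have := h.resolve_left hsmall
      linarith
    push Not at hsmall
    obtain ⟨i, j, hij⟩ := exists_le_sq_of_lt_frobNorm hB
    refine card_filter_dMah_lt_le hδ hcard hΓ (w := Pi.single j 1) (by simp) ?_
    have hentry : |B i j| ≤ ‖(-(B *ᵥ Pi.single j 1), (Pi.single j 1 : Fin q → ℝ))‖ := by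
      refine le_trans ?_ (norm_fst_le _)
      simpa using norm_le_pi_norm (-(B *ᵥ Pi.single j 1)) i
    calc R ^ 2 * (Pi.single j 1 ⬝ᵥ (Γ *ᵥ Pi.single j 1)) = R ^ 2 * Γ j j := by simp
      _ ≤ R ^ 2 * (q / t₁ ^ (q - 1)) := by
          gcongr
          exact diag_le_of_det_eq_one hΓ hdet ht₁pos (fun i => (hsmall i).le) j
      _ = δ ^ 2 * M := by
          rw [hM]
          field_simp
      _ ≤ δ ^ 2 * |B i j| ^ 2 := by
          rw [sq_abs]
          gcongr
      _ ≤ _ := by gcongr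
end
end

section
/- Let Z = {z₁, …, zₙ} with z_i = (y_i′, x_i′) ∈ ℝ^{q+p}, let ρ₀ be a ρ-function, and let (B̃, Σ̃) be an ℝ^{p×q} × S_q–valued estimator with finite-sample breakdown point ε*ₙ(Z, B̃, Σ̃). For a contaminated sample Z* ∈ Z_m write (B̃*, Σ̃*) = (B̃(Z*), Σ̃(Z*)). Then for every integer m < min(n·ε*ₙ(Z, B̃, Σ̃), n/2), sup over Z* ∈ Z_m of the M-estimate of scale s(d₁(B̃*, Σ̃*), …, dₙ(B̃*, Σ̃*)) (computed with ρ₀ and b = m/n-admissible b = 0.5, on the sample Z*) is finite. In particular the explosion breakdown point of this scale estimate is bounded below by min(ε*ₙ(Z, B̃, Σ̃), 0.5). -/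
open MeasureTheory Matrix Filter ProbabilityTheory

noncomputable section

instance {m n : ℕ} : MeasurableSpace (Matrix (Fin m) (Fin n) ℝ) :=
  inferInstanceAs (MeasurableSpace (Fin m → Fin n → ℝ))

attribute [local instance] Classical.propDecidable
/-- The set of samples differing from `Z` in at most `m` points. -/
def contamSet {n : ℕ} {α : Type*} (Z : Fin n → α) (m : ℕ) : Set (Fin n → α) :=
  {Z' | (n - m : ℕ) ≤ (Finset.univ.filter (fun i => Z i = Z' i)).card}

/-- Largest eigenvalue of a (symmetric) matrix. -/
def lamMax {q : ℕ} (A : Matrix (Fin q) (Fin q) ℝ) : ℝ :=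
  sSup {r : ℝ | ∃ v : Fin q → ℝ, v ≠ 0 ∧ A *ᵥ v = r • v}

/-- Smallest eigenvalue of a (symmetric) matrix. -/
def lamMin {q : ℕ} (A : Matrix (Fin q) (Fin q) ℝ) : ℝ :=
  sInf {r : ℝ | ∃ v : Fin q → ℝ, v ≠ 0 ∧ A *ᵥ v = r • v}

/-- `m* = min{m : sup_{Z* ∈ Z_m} ‖B̂(Z*)‖₂ = ∞}` (as an extended natural, `⊤` if the
estimator never breaks down). -/
noncomputable def mStarB {n p q : ℕ}
    (Z : Fin n → (Fin q → ℝ) × (Fin p → ℝ))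
    (Bh : (Fin n → (Fin q → ℝ) × (Fin p → ℝ)) → Matrix (Fin p) (Fin q) ℝ) : ℕ∞ :=
  sInf ((fun k : ℕ => (k : ℕ∞)) ''
    {k : ℕ | ¬ BddAbove ((fun Z' => frobNorm (Bh Z')) '' contamSet Z k)})

/-- `m* = min{m : sup_{Z* ∈ Z_m} λ₁(Σ̂(Z*)) = ∞ or inf_{Z* ∈ Z_m} λ_q(Σ̂(Z*)) = 0}`. -/
noncomputable def mStarS {n p q : ℕ}
    (Z : Fin n → (Fin q → ℝ) × (Fin p → ℝ))
    (Sh : (Fin n → (Fin q → ℝ) × (Fin p → ℝ)) → Matrix (Fin q) (Fin q) ℝ) : ℕ∞ :=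
  sInf ((fun k : ℕ => (k : ℕ∞)) ''
    {k : ℕ | ¬ BddAbove ((fun Z' => lamMax (Sh Z')) '' contamSet Z k) ∨
      ¬ ∃ c > (0 : ℝ), ∀ Z' ∈ contamSet Z k, c ≤ lamMin (Sh Z')})

/-- A lower bound on the smallest eigenvalue bounds the quadratic form from below. -/
lemma mul_dotProduct_self_le_of_le_lamMin {q : ℕ} {S : Matrix (Fin q) (Fin q) ℝ}
    (hS : S.PosDef) {c : ℝ} (hc : c ≤ lamMin S) (w : Fin q → ℝ) :
    c * (w ⬝ᵥ w) ≤ w ⬝ᵥ (S *ᵥ w) := by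
  have hbdd : BddBelow {r : ℝ | ∃ v : Fin q → ℝ, v ≠ 0 ∧ S *ᵥ v = r • v} := by
    refine ⟨0, ?_⟩
    rintro r ⟨v, hv, hr⟩
    have h1 := hS.dotProduct_mulVec_pos hv
    have h2 : 0 < v ⬝ᵥ v := by
      simpa using (dotProduct_star_self_pos_iff (v := v)).2 hv
    rw [hr, star_trivial, dotProduct_smul, smul_eq_mul] at h1
    exact (pos_of_mul_pos_left h1 h2.le).le
  have hH : (S - c • (1 : Matrix (Fin q) (Fin q) ℝ)).IsHermitian := by
    refine hS.isHermitian.sub ?_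
    simp [Matrix.IsHermitian]
  have hpsd : (S - c • (1 : Matrix (Fin q) (Fin q) ℝ)).PosSemidef := by
    rw [hH.posSemidef_iff_eigenvalues_nonneg]
    intro i
    have he := hH.mulVec_eigenvectorBasis i
    have hne : (hH.eigenvectorBasis i).ofLp ≠ 0 := by
      intro h0
      have h1 := hH.eigenvectorBasis.orthonormal.ne_zero i
      exact h1 (by ext j; exact congrFun h0 j)
    have hmem : hH.eigenvalues i + c ∈
        {r : ℝ | ∃ v : Fin q → ℝ, v ≠ 0 ∧ S *ᵥ v = r • v} := by
      refine ⟨_, hne, ?_⟩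
      rw [sub_mulVec, smul_mulVec, one_mulVec, sub_eq_iff_eq_add] at he
      rw [he, add_smul]
    have hle : lamMin S ≤ hH.eigenvalues i + c := csInf_le hbdd hmem
    simp only [Pi.zero_apply]
    linarith
  have h := hpsd.dotProduct_mulVec_nonneg w
  rw [star_trivial, sub_mulVec, smul_mulVec, one_mulVec, dotProduct_sub, dotProduct_smul,
    smul_eq_mul] at h
  linarith

/-- The squared Mahalanobis norm is at most the squared Euclidean norm over `c ≤ lamMin S`. -/
lemma mahSq_le_div_of_le_lamMin {q : ℕ} {S : Matrix (Fin q) (Fin q) ℝ} (hS : S.PosDef)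
    {c : ℝ} (hc0 : 0 < c) (hc : c ≤ lamMin S) (u : Fin q → ℝ) :
    mahSq S u ≤ (∑ j, u j ^ 2) / c := by
  unfold mahSq
  set w := S⁻¹ *ᵥ u with hw
  have hSw : S *ᵥ w = u := by
    rw [hw, mulVec_mulVec, mul_nonsing_inv _ ((isUnit_iff_isUnit_det _).1 hS.isUnit),
      one_mulVec]
  have h1 := mul_dotProduct_self_le_of_le_lamMin hS hc w
  rw [hSw, dotProduct_comm w u] at h1
  have hcs : (u ⬝ᵥ w) ^ 2 ≤ (∑ j, u j ^ 2) * (w ⬝ᵥ w) := by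
    have := Finset.sum_mul_sq_le_sq_mul_sq Finset.univ u w
    simpa [dotProduct, pow_two] using this
  have hw0 : 0 ≤ w ⬝ᵥ w := by
    simpa using dotProduct_star_self_nonneg w
  have hu0 : 0 ≤ ∑ j, u j ^ 2 := Finset.sum_nonneg fun j _ => sq_nonneg _
  rw [le_div_iff₀ hc0]
  rcases (le_trans (mul_nonneg hc0.le hw0) h1).eq_or_lt with h0 | hpos
  · rw [← h0, zero_mul]
    exact hu0
  · refine le_of_mul_le_mul_right ?_ hpos
    calc u ⬝ᵥ w * c * (u ⬝ᵥ w) = c * (u ⬝ᵥ w) ^ 2 := by ring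
      _ ≤ c * ((∑ j, u j ^ 2) * (w ⬝ᵥ w)) := mul_le_mul_of_nonneg_left hcs hc0.le
      _ = (∑ j, u j ^ 2) * (c * (w ⬝ᵥ w)) := by ring
      _ ≤ (∑ j, u j ^ 2) * (u ⬝ᵥ w) := mul_le_mul_of_nonneg_left h1 hu0

lemma abs_apply_le_frobNorm {p q : ℕ} (A : Matrix (Fin p) (Fin q) ℝ) (i : Fin p) (j : Fin q) :
    |A i j| ≤ frobNorm A := by
  refine Real.abs_le_sqrt ?_
  calc A i j ^ 2 ≤ ∑ j, A i j ^ 2 :=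
        Finset.single_le_sum (f := fun j => A i j ^ 2) (fun _ _ => sq_nonneg _)
          (Finset.mem_univ j)
    _ ≤ ∑ i, ∑ j, A i j ^ 2 :=
        Finset.single_le_sum (f := fun i => ∑ j, A i j ^ 2)
          (fun _ _ => Finset.sum_nonneg fun _ _ => sq_nonneg _) (Finset.mem_univ i)

lemma abs_resid_le {p q : ℕ} {B : Matrix (Fin p) (Fin q) ℝ} {K : ℝ} (hB : frobNorm B ≤ K)
    (z : (Fin q → ℝ) × (Fin p → ℝ)) (j : Fin q) :
    |resid B z j| ≤ |z.1 j| + ∑ k, K * |z.2 k| := by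
  have h : resid B z j = z.1 j - ∑ k, B k j * z.2 k := rfl
  rw [h]
  refine (abs_sub _ _).trans (add_le_add le_rfl ?_)
  refine (Finset.abs_sum_le_sum_abs _ _).trans (Finset.sum_le_sum fun k _ => ?_)
  rw [abs_mul]
  exact mul_le_mul_of_nonneg_right ((abs_apply_le_frobNorm B k j).trans hB) (abs_nonneg _)

/-- Over bounded `B` and `Σ` with eigenvalues bounded away from zero, the Mahalanobis norms of
the residuals of finitely many fixed observations are uniformly bounded. -/
lemma exists_dMah_le {n p q : ℕ} (Z : Fin n → (Fin q → ℝ) × (Fin p → ℝ)) (K : ℝ) {c : ℝ}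
    (hc0 : 0 < c) :
    ∃ D, 0 ≤ D ∧ ∀ (B : Matrix (Fin p) (Fin q) ℝ) (S : Matrix (Fin q) (Fin q) ℝ),
      frobNorm B ≤ K → S.PosDef → c ≤ lamMin S → ∀ i, dMah B S (Z i) ≤ D := by
  set R : Fin n → ℝ :=
    fun i => Real.sqrt ((∑ j, (|(Z i).1 j| + ∑ k, K * |(Z i).2 k|) ^ 2) / c) with hR
  have hR0 : ∀ i, 0 ≤ R i := fun i => Real.sqrt_nonneg _
  refine ⟨∑ i, R i, Finset.sum_nonneg fun i _ => hR0 i, fun B S hB hS hc i => ?_⟩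
  refine le_trans ?_ (Finset.single_le_sum (fun i _ => hR0 i) (Finset.mem_univ i))
  refine Real.sqrt_le_sqrt ((mahSq_le_div_of_le_lamMin hS hc0 hc _).trans ?_)
  refine div_le_div_of_nonneg_right (Finset.sum_le_sum fun j _ => ?_) hc0.le
  rw [← sq_abs]
  exact pow_le_pow_left₀ (abs_nonneg _) (abs_resid_le hB (Z i) j) 2

/-- If all but at most `m < n / 2` of the nonnegative values are bounded by `D`, the M-scale is
bounded by a constant depending only on `ρ₀`, `n`, `m` and `D`. -/
lemma exists_isMScale_le {n m : ℕ} {ρ₀ : ℝ → ℝ} (hρ₀ : IsRhoFunction ρ₀)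
    (hm : (m : ℝ) < (n : ℝ) / 2) {D : ℝ} (hD : 0 ≤ D) :
    ∃ t₀ : ℝ, ∀ (v : Fin n → ℝ) (G : Finset (Fin n)), (∀ i, 0 ≤ v i) → (∀ i ∈ G, v i ≤ D) →
      n - m ≤ G.card → ∀ s, IsMScale ρ₀ (1 / 2) v s → s ≤ t₀ := by
  have hn : (0 : ℝ) < n := by linarith [(Nat.cast_nonneg m : (0 : ℝ) ≤ m)]
  have hδ : 0 < ((n : ℝ) / 2 - m) / n := div_pos (by linarith) hn
  obtain ⟨η, hη, hball⟩ := Metric.continuousAt_iff.1 (hρ₀.continuous.continuousAt (x := 0)) _ hδ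
  refine ⟨D / η, fun v G hv hG hcard s hs => ?_⟩
  rcases hs with ⟨hs, hsum⟩ | ⟨rfl, -⟩
  swap
  · exact div_nonneg hD hη.le
  by_contra! hlt
  have hsmall : ρ₀ (D / s) < ((n : ℝ) / 2 - m) / n := by
    have hDs : D / s < η := by
      rw [div_lt_iff₀ hs]
      rw [div_lt_iff₀ hη] at hlt
      linarith
    have h := hball (x := D / s) (by
      rw [Real.dist_eq, sub_zero, abs_of_nonneg (div_nonneg hD hs.le)]
      exact hDs)
    rw [Real.dist_eq, hρ₀.map_zero, sub_zero] at h
    exact lt_of_le_of_lt (le_abs_self _) h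
  have hcompl : ((Gᶜ).card : ℝ) ≤ m := by
    have := Finset.card_add_card_compl G
    rw [Fintype.card_fin] at this
    exact_mod_cast (by omega : (Gᶜ).card ≤ m)
  have hgood : ∑ i ∈ G, ρ₀ (v i / s) ≤ n * ρ₀ (D / s) := by
    have hGn : (G.card : ℝ) ≤ n := by
      exact_mod_cast (by simpa using Finset.card_le_univ G : G.card ≤ n)
    have h : ∑ i ∈ G, ρ₀ (v i / s) ≤ G.card • ρ₀ (D / s) := by
      refine Finset.sum_le_card_nsmul _ _ _ fun i hi => hρ₀.mono_abs _ _ ?_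
      rw [abs_of_nonneg (div_nonneg (hv i) hs.le), abs_of_nonneg (div_nonneg hD hs.le)]
      exact div_le_div_of_nonneg_right (hG i hi) hs.le
    rw [nsmul_eq_mul] at h
    exact h.trans (mul_le_mul_of_nonneg_right hGn (hρ₀.nonneg _))
  have hbad : ∑ i ∈ Gᶜ, ρ₀ (v i / s) ≤ m := by
    have h := Finset.sum_le_card_nsmul Gᶜ (fun i => ρ₀ (v i / s)) 1 fun i _ => hρ₀.le_one _
    rw [nsmul_eq_mul, mul_one] at h
    exact h.trans hcompl
  have hsplit := Finset.sum_add_sum_compl G (fun i => ρ₀ (v i / s))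
  rw [lt_div_iff₀ hn] at hsmall
  linarith

/-- Lemma `lemaBP` of the paper: for every `m < min(n·ε*ₙ(Z,B̃,Σ̃), n/2)`,
the M-estimates of scale of the Mahalanobis norms of the residuals, computed on samples
`Z* ∈ Z_m`, are uniformly bounded. -/
theorem mscale_breakdown_bound {n p q : ℕ}
    (Z : Fin n → (Fin q → ℝ) × (Fin p → ℝ))
    (ρ₀ : ℝ → ℝ) (hρ₀ : IsRhoFunction ρ₀)
    (Btil : (Fin n → (Fin q → ℝ) × (Fin p → ℝ)) → Matrix (Fin p) (Fin q) ℝ)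
    (Stil : (Fin n → (Fin q → ℝ) × (Fin p → ℝ)) → Matrix (Fin q) (Fin q) ℝ)
    (hStilpd : ∀ Z', (Stil Z').PosDef)
    (m : ℕ)
    (hm₁ : (m : ℕ∞) < min (mStarB Z Btil) (mStarS Z Stil))
    (hm₂ : (m : ℝ) < (n : ℝ) / 2) :
    ∃ t₀ : ℝ, ∀ Z' ∈ contamSet Z m, ∀ s : ℝ,
      IsMScale ρ₀ (1 / 2) (fun i => dMah (Btil Z') (Stil Z') (Z' i)) s → s ≤ t₀ := by
  have hB : BddAbove ((fun Z' => frobNorm (Btil Z')) '' contamSet Z m) := by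
    by_contra h
    exact absurd (hm₁.trans_le (min_le_left _ _)) (not_lt.2 (sInf_le ⟨m, h, rfl⟩))
  have hS : ∃ c > (0 : ℝ), ∀ Z' ∈ contamSet Z m, c ≤ lamMin (Stil Z') := by
    by_contra h
    exact absurd (hm₁.trans_le (min_le_right _ _)) (not_lt.2 (sInf_le ⟨m, Or.inr h, rfl⟩))
  obtain ⟨K, hK⟩ := hB
  obtain ⟨c, hc0, hc⟩ := hS
  obtain ⟨D, hD0, hD⟩ := exists_dMah_le Z K hc0
  obtain ⟨t₀, ht₀⟩ := exists_isMScale_le hρ₀ hm₂ hD0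
  refine ⟨t₀, fun Z' hZ' => ht₀ _ _ (fun i => Real.sqrt_nonneg _) (fun i hi => ?_) hZ'⟩
  have hi' : Z i = Z' i := by simpa using hi
  rw [← hi']
  exact hD _ _ (hK ⟨Z', hZ', rfl⟩) (hStilpd Z') (hc Z' hZ') i
end
end

section
/- Let u₁, …, uₙ ∈ ℝ^q and ω₁, …, ωₙ ≥ 0 be such that C = ∑_{i=1}^n ω_i u_i u_i′ is positive definite. Then Γ = C/(det C)^{1/q} minimizes ∑_{i=1}^n ω_i u_i′ V⁻¹ u_i over all V ∈ S_q with det V = 1; i.e., for every symmetric positive definite V with det V = 1, ∑_{i=1}^n ω_i u_i′ Γ⁻¹ u_i ≤ ∑_{i=1}^n ω_i u_i′ V⁻¹ u_i. -/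
open MeasureTheory Matrix Filter ProbabilityTheory

noncomputable section

/-- **AM-GM inequality** for the eigenvalues of a positive semidefinite matrix. -/
theorem Matrix.PosSemidef.card_mul_det_rpow_le_trace {m : Type*} [Fintype m] [DecidableEq m]
    {M : Matrix m m ℝ} (hM : M.PosSemidef) :
    Fintype.card m * M.det ^ ((1 : ℝ) / Fintype.card m) ≤ M.trace := by
  cases isEmpty_or_nonempty m
  · simp [Matrix.trace]
  have hcard : (0 : ℝ) < Fintype.card m := by exact_mod_cast Fintype.card_pos
  have h := Real.geom_mean_le_arith_mean Finset.univ (fun _ : m => (1 : ℝ))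
    hM.isHermitian.eigenvalues (by simp) (by simpa using hcard)
    (fun i _ => hM.eigenvalues_nonneg i)
  rw [hM.isHermitian.det_eq_prod_eigenvalues, hM.isHermitian.trace_eq_sum_eigenvalues]
  simp only [Real.rpow_one, one_mul, Finset.sum_const, Finset.card_univ, nsmul_eq_mul,
    mul_one, le_div_iff₀ hcard] at h
  simpa [mul_comm] using h

open scoped MatrixOrder Matrix.Norms.L2Operator in
/-- A trace bound for the product of two positive semidefinite matrices. -/
theorem Matrix.PosSemidef.card_mul_det_mul_rpow_le_trace_mul {m : Type*} [Fintype m]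
    [DecidableEq m] {A C : Matrix m m ℝ} (hA : A.PosSemidef) (hC : C.PosSemidef) :
    Fintype.card m * (A * C).det ^ ((1 : ℝ) / Fintype.card m) ≤ (A * C).trace := by
  obtain ⟨B, rfl⟩ := CStarAlgebra.nonneg_iff_eq_star_mul_self.mp hA.nonneg
  rw [Matrix.star_eq_conjTranspose]
  have h := (hC.mul_mul_conjTranspose_same B).card_mul_det_rpow_le_trace
  have hdet : (B * C * Bᴴ).det = (Bᴴ * B * C).det := by
    simp only [Matrix.det_mul]; ring
  rwa [hdet, Matrix.trace_mul_comm, ← Matrix.mul_assoc] at h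

/-- A weighted sum of squared Mahalanobis norms is a trace against the weighted scatter matrix. -/
theorem sum_mul_mahSq_eq_trace {n q : ℕ} (u : Fin n → (Fin q → ℝ)) (ω : Fin n → ℝ)
    (V : Matrix (Fin q) (Fin q) ℝ) :
    ∑ i, ω i * mahSq V (u i) = (V⁻¹ * ∑ i, ω i • vecMulVec (u i) (u i)).trace := by
  simp [Finset.mul_sum, Matrix.trace_sum, mahSq, Matrix.mul_vecMulVec, Matrix.trace_vecMulVec,
    dotProduct_comm]

/-- if `C = ∑ᵢ ωᵢ uᵢ uᵢ′` is positive definite (`ωᵢ ≥ 0`), then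
`Γ = C/(det C)^{1/q}` minimizes `∑ᵢ ωᵢ uᵢ′ V⁻¹ uᵢ` over all symmetric positive definite
`V` with `det V = 1`. -/
theorem normalized_weighted_scatter_minimizes {n q : ℕ}
    (u : Fin n → (Fin q → ℝ)) (ω : Fin n → ℝ) (hω : ∀ i, 0 ≤ ω i)
    (C : Matrix (Fin q) (Fin q) ℝ) (hC : C = ∑ i, ω i • vecMulVec (u i) (u i))
    (hCpd : C.PosDef)
    (Γ : Matrix (Fin q) (Fin q) ℝ) (hΓ : Γ = (C.det ^ ((1 : ℝ) / q))⁻¹ • C) :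
    ∀ V : Matrix (Fin q) (Fin q) ℝ, V.PosDef → V.det = 1 →
      ∑ i, ω i * mahSq Γ (u i) ≤ ∑ i, ω i * mahSq V (u i) := by
  intro V hV hdet
  rw [sum_mul_mahSq_eq_trace, sum_mul_mahSq_eq_trace, ← hC]
  have hpos : 0 < C.det := hCpd.det_pos
  have hd : C.det ^ ((1 : ℝ) / q) ≠ 0 := (Real.rpow_pos_of_pos hpos _).ne'
  have hinv : Γ⁻¹ * C = C.det ^ ((1 : ℝ) / q) • (1 : Matrix (Fin q) (Fin q) ℝ) := by
    have hΓinv : Γ⁻¹ = C.det ^ ((1 : ℝ) / q) • C⁻¹ := by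
      apply Matrix.inv_eq_left_inv
      rw [hΓ, smul_mul_smul_comm, mul_inv_cancel₀ hd, one_smul,
        Matrix.nonsing_inv_mul C hpos.ne'.isUnit]
    rw [hΓinv, smul_mul_assoc, Matrix.nonsing_inv_mul C hpos.ne'.isUnit]
  have h := hV.inv.posSemidef.card_mul_det_mul_rpow_le_trace_mul hCpd.posSemidef
  have hVC : (V⁻¹ * C).det = C.det := by simp [Matrix.det_nonsing_inv, hdet]
  rw [hVC, Fintype.card_fin] at h
  rw [hinv, Matrix.trace_smul, Matrix.trace_one, Fintype.card_fin, smul_eq_mul, mul_comm]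
  exact h
end
end
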